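/- arXiv:2105.03490 — 2 statements merged into one kernel-verified Lean document; each statement's English description precedes it below -/
import Mathlib

section
/- Fix n ≥ 2 vehicles with radii R_1, …, R_n > 0 and a configuration x = (x^1, …, x^n) ∈ (ℝ²)^n with x^i ≠ x^j for all i < j. Let h > 0 and let V = (V^1,…,V^n) ∈ (ℝ²)^n satisfy the admissible velocity constraints D_{ij}(x) + h ⟨∇D_{ij}(x), V⟩ ≥ 0 for all i < j, i.e., V ∈ C_h(x). Then the next configuration x + hV is admissible: D_{ij}(x + hV) ≥ 0 for all i < j, i.e., x + hV ∈ A (taking an admissible velocity prevents collisions, with no remainder term needed). -/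
open RealInnerProductSpace

/-- The norm lies above its tangent at a nonzero point `d`. -/
theorem norm_add_mul_inner_div_norm_le {E : Type*} [NormedAddCommGroup E]
    [InnerProductSpace ℝ E] {d : E} (hd : d ≠ 0) (w : E) (h : ℝ) :
    ‖d‖ + h * (⟪d, w⟫ / ‖d‖) ≤ ‖d + h • w‖ := by
  have hpos : 0 < ‖d‖ := norm_pos_iff.mpr hd
  have hcs := real_inner_le_norm d (d + h • w)
  rw [inner_add_right, inner_smul_right, real_inner_self_eq_norm_mul_norm] at hcs
  refine le_of_mul_le_mul_left (le_trans (le_of_eq ?_) hcs) hpos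
  field_simp

/-- Taking an admissible velocity prevents collisions with no remainder term:
if `V ∈ C_h(x)`, i.e. `D_ij(x) + h ⟨∇D_ij(x), V⟩ ≥ 0` for all `i < j`, then the
next configuration `x + h V` is admissible: `D_ij(x + h V) ≥ 0` for all
`i < j`. -/
theorem admissible_velocity_gives_admissible_configuration
    (n : ℕ) (hn : 2 ≤ n) (R : Fin n → ℝ) (hR : ∀ i, 0 < R i)
    (x V : Fin n → EuclideanSpace ℝ (Fin 2))
    (hx : ∀ i j : Fin n, i < j → x i ≠ x j)
    (h : ℝ) (hh : 0 < h)
    (hV : ∀ i j : Fin n, i < j →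
      0 ≤ (‖x i - x j‖ - (R i + R j)) +
            h * (⟪x i - x j, V i - V j⟫ / ‖x i - x j‖)) :
    ∀ i j : Fin n, i < j →
      0 ≤ ‖(x i + h • V i) - (x j + h • V j)‖ - (R i + R j) := by
  intro i j hij
  have htangent := norm_add_mul_inner_div_norm_le
    (sub_ne_zero.mpr (hx i j hij)) (V i - V j) h
  have hsub : (x i + h • V i) - (x j + h • V j) = (x i - x j) + h • (V i - V j) := by
    rw [smul_sub]
    abel
  rw [hsub]
  linarith [hV i j hij]
end

section
/- Fix n ≥ 2 vehicles with radii R_1, …, R_n > 0 and a configuration x = (x^1, …, x^n) ∈ (ℝ²)^n with x^i ≠ x^j for all i < j. Then the set K(x) = { y ∈ (ℝ²)^n : D_{ij}(x) + ⟨∇D_{ij}(x), y − x⟩ ≥ 0 for all i < j } is a nonempty, closed, convex subset of (ℝ²)^n whenever x ∈ A; in fact x ∈ A implies x ∈ K(x), and K(x) ⊆ A, i.e., every point of the linearized admissible set is an admissible (nonoverlapping) configuration. -/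
open RealInnerProductSpace

section Linearization

variable {E : Type*} [NormedAddCommGroup E] [InnerProductSpace ℝ E]

/-- Linearizing `‖·‖ - r` at `u ≠ 0` gives the affine function `w ↦ ⟪u, w⟫ / ‖u‖ - r`. -/
lemma norm_sub_add_inner_sub_div_norm {u : E} (hu : u ≠ 0) (w : E) (r : ℝ) :
    ‖u‖ - r + ⟪u, w - u⟫ / ‖u‖ = ⟪u, w⟫ / ‖u‖ - r := by
  have h : ‖u‖ ≠ 0 := norm_ne_zero_iff.mpr hu
  rw [inner_sub_right, real_inner_self_eq_norm_sq]
  field_simp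
  ring

lemma inner_div_norm_le_norm (u w : E) : ⟪u, w⟫ / ‖u‖ ≤ ‖w‖ :=
  div_le_of_le_mul₀ (norm_nonneg u) (norm_nonneg w)
    ((real_inner_le_norm u w).trans_eq (mul_comm _ _))

lemma isClosed_setOf_le_inner_sub_div_norm {ι : Type*} (u : E) (r : ℝ) (i j : ι) :
    IsClosed {y : ι → E | r ≤ ⟪u, y i - y j⟫ / ‖u‖} :=
  isClosed_le continuous_const (by fun_prop)

lemma convex_setOf_le_inner_sub_div_norm {ι : Type*} (u : E) (r : ℝ) (i j : ι) :
    Convex ℝ {y : ι → E | r ≤ ⟪u, y i - y j⟫ / ‖u‖} := by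
  refine convex_halfSpace_ge ⟨fun y z => ?_, fun c y => ?_⟩ r
  · simp only [Pi.add_apply, add_sub_add_comm, inner_add_right, add_div]
  · simp only [Pi.smul_apply, ← smul_sub, real_inner_smul_right, smul_eq_mul, mul_div_assoc]

end Linearization


/-- For an admissible configuration `x ∈ A`, the linearized admissible set
`K(x) = {y | D_ij(x) + ⟨∇D_ij(x), y - x⟩ ≥ 0 for all i < j}` is nonempty
(indeed `x ∈ K(x)`), closed, convex, and contained in the admissible set
`A = {y | D_ij(y) ≥ 0 for all i < j}`. -/
theorem linearized_admissible_set_properties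
    (n : ℕ) (hn : 2 ≤ n) (R : Fin n → ℝ) (hR : ∀ i, 0 < R i)
    (x : Fin n → EuclideanSpace ℝ (Fin 2))
    (hx : ∀ i j : Fin n, i < j → x i ≠ x j)
    (hxA : ∀ i j : Fin n, i < j → 0 ≤ ‖x i - x j‖ - (R i + R j))
    (K : Set (Fin n → EuclideanSpace ℝ (Fin 2)))
    (hK : K = {y | ∀ i j : Fin n, i < j →
      0 ≤ (‖x i - x j‖ - (R i + R j)) +
            ⟪x i - x j, (y i - x i) - (y j - x j)⟫ / ‖x i - x j‖}) :
    x ∈ K ∧ K.Nonempty ∧ IsClosed K ∧ Convex ℝ K ∧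
      K ⊆ {y | ∀ i j : Fin n, i < j → 0 ≤ ‖y i - y j‖ - (R i + R j)} := by
  have hK' : K = ⋂ (i) (j) (_ : i < j),
      {y | R i + R j ≤ ⟪x i - x j, y i - y j⟫ / ‖x i - x j‖} := by
    ext y
    simp only [hK, Set.mem_ofPred_eq, Set.mem_iInter]
    refine forall₃_congr fun i j hij => ?_
    rw [sub_sub_sub_comm,
      norm_sub_add_inner_sub_div_norm (sub_ne_zero.mpr (hx i j hij)), sub_nonneg]
  have hxK : x ∈ K := by
    rw [hK]
    intro i j hij
    simpa using hxA i j hij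
  refine ⟨hxK, ⟨x, hxK⟩, ?_, ?_, fun y hy i j hij => ?_⟩
  · rw [hK']
    exact isClosed_iInter fun i => isClosed_iInter fun j => isClosed_iInter fun _ =>
      isClosed_setOf_le_inner_sub_div_norm _ _ i j
  · rw [hK']
    exact convex_iInter fun i => convex_iInter fun j => convex_iInter fun _ =>
      convex_setOf_le_inner_sub_div_norm _ _ i j
  · simp only [hK', Set.mem_iInter] at hy
    exact sub_nonneg.mpr ((hy i j hij).trans (inner_div_norm_le_norm _ _))
end
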